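/- arXiv:1301.4727 — 6 statements merged into one kernel-verified Lean document; each statement's English description precedes it below -/
import Mathlib

section
/- Fix integers n ≥ 2 and m with gcd(m,n) = 1, and let P(z) = ∏_{j=1}^{l}(z − a_j)^{k_j} ∈ ℂ[z], where a_1, …, a_l ∈ ℂ are distinct and k_1, …, k_l are positive integers. Let Y = {(x,y,z) ∈ ℂ³ : xy = P(z^n)}. Then: (i) for every ζ ∈ ℂ with ζ^n = 1, the map σ_ζ(x,y,z) = (ζx, ζ^{-1}y, ζ^m z) maps Y into Y; (ii) the resulting action of the n-th roots of unity on Y is free (i.e., for every ζ with ζ^n = 1 and ζ ≠ 1, σ_ζ has no fixed point on Y) if and only if a_j ≠ 0 for all j = 1, …, l. -/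
/-- An element killed by two coprime exponents is trivial. -/
theorem eq_one_of_zpow_eq_one_of_pow_eq_one {G₀ : Type*} [GroupWithZero G₀] {ζ : G₀} {m : ℤ}
    {n : ℕ} (hζ : ζ ≠ 0) (hmn : Int.gcd m (n : ℤ) = 1) (hm : ζ ^ m = 1) (hn : ζ ^ n = 1) :
    ζ = 1 := by
  have bezout := Int.gcd_eq_gcd_ab m n
  rw [hmn, Nat.cast_one] at bezout
  calc ζ = ζ ^ (m * Int.gcdA m n + n * Int.gcdB m n) := by rw [← bezout, zpow_one]
    _ = 1 := by
      rw [zpow_add₀ hζ, zpow_mul, zpow_mul, zpow_natCast, hm, hn, one_zpow, one_zpow, one_mul]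


/-- Fix `n ≥ 2` and an integer `m` with `gcd(m,n) = 1`, and let
`P(z) = ∏ (z - aⱼ)^{kⱼ}` with the `aⱼ` distinct and `kⱼ > 0`.
Let `Y = {(x,y,z) : xy = P(zⁿ)}`. Then:
(i) for every `ζ` with `ζⁿ = 1`, the map `(x,y,z) ↦ (ζx, ζ⁻¹y, ζᵐz)` maps `Y` into `Y`;
(ii) this action of the `n`-th roots of unity on `Y` is free iff `aⱼ ≠ 0` for all `j`. -/
theorem stmt_1 (n : ℕ) (hn : 2 ≤ n) (m : ℤ) (hm : Int.gcd m (n : ℤ) = 1)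
    (l : ℕ) (a : Fin l → ℂ) (ha : Function.Injective a)
    (k : Fin l → ℕ) (hk : ∀ j, 0 < k j) :
    (∀ ζ : ℂ, ζ ^ n = 1 →
      ∀ p : ℂ × ℂ × ℂ, p.1 * p.2.1 = ∏ j, (p.2.2 ^ n - a j) ^ k j →
        (ζ * p.1) * (ζ⁻¹ * p.2.1) = ∏ j, ((ζ ^ m * p.2.2) ^ n - a j) ^ k j) ∧
    ((∀ ζ : ℂ, ζ ^ n = 1 → ζ ≠ 1 →
        ∀ p : ℂ × ℂ × ℂ, p.1 * p.2.1 = ∏ j, (p.2.2 ^ n - a j) ^ k j →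
          (ζ * p.1, ζ⁻¹ * p.2.1, ζ ^ m * p.2.2) ≠ p) ↔
      ∀ j, a j ≠ 0) := by
  have hn0 : n ≠ 0 := by omega
  have ne_zero_of_pow {ζ : ℂ} (hζ : ζ ^ n = 1) : ζ ≠ 0 := by
    rintro rfl
    simp [hn0] at hζ
  refine ⟨fun ζ hζ p hp => ?_, fun hfree j hj => ?_, fun hne ζ hζ hζ1 p hp hfix => ?_⟩
  · have hpow : (ζ ^ m) ^ n = 1 := by
      rw [← zpow_natCast, zpow_comm, zpow_natCast, hζ, one_zpow]
    rw [mul_mul_mul_comm, mul_inv_cancel₀ (ne_zero_of_pow hζ), one_mul, hp, mul_pow, hpow,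
      one_mul]
  · have hprim := Complex.isPrimitiveRoot_exp n hn0
    refine hfree _ hprim.pow_eq_one (hprim.ne_one (by omega)) (0, 0, 0) ?_ (by simp)
    rw [Finset.prod_eq_zero (Finset.mem_univ j)]
    · simp
    · simp [hj, hn0, (hk j).ne']
  · obtain ⟨x, y, z⟩ := p
    simp only [Prod.mk.injEq] at hfix hp
    obtain ⟨hx, -, hz⟩ := hfix
    have hx0 : x = 0 := by
      by_contra h
      exact hζ1 ((mul_eq_right₀ h).mp hx)
    have hz0 : z = 0 := by
      by_contra h
      exact hζ1 (eq_one_of_zpow_eq_one_of_pow_eq_one (ne_zero_of_pow hζ) hm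
        ((mul_eq_right₀ h).mp hz) hζ)
    rw [hx0, hz0, zero_mul, zero_pow hn0] at hp
    obtain ⟨j, -, hj⟩ := Finset.prod_eq_zero_iff.mp hp.symm
    exact hne j (by simpa using pow_eq_zero_iff (hk j).ne' |>.mp hj)
end

section
/- Let d, n, m be positive integers with gcd(m,n) = 1, and let f : ℂ² → ℂ³ be defined by f(z_1,z_2) = (z_1^{dn}, z_2^{dn}, z_1 z_2). Then for all p = (p_1,p_2) and q = (q_1,q_2) in ℂ², the following are equivalent: (a) there exists ζ ∈ ℂ with ζ^n = 1 such that, writing f(p) = (x,y,z), one has f(q) = (ζ x, ζ^{-1} y, ζ^m z); (b) there exists ε ∈ ℂ with ε^{dn²} = 1 such that q = (ε p_1, ε^{dnm−1} p_2). In other words, the fibers of the composition of f with the quotient of ℂ³ by the (1/n)(1,−1,m)-action of the n-th roots of unity are exactly the orbits of the (1/(dn²))(1, dnm−1)-action of the dn²-th roots of unity on ℂ². -/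
/-- For positive integers `d, n, m` with `gcd(m,n) = 1` and
`f(z₁,z₂) = (z₁^{dn}, z₂^{dn}, z₁z₂)`, the following are equivalent for `p, q ∈ ℂ²`:
(a) there is `ζ` with `ζⁿ = 1` such that `f(q) = (ζx, ζ⁻¹y, ζᵐz)` where `f(p) = (x,y,z)`;
(b) there is `ε` with `ε^{dn²} = 1` such that `q = (ε p₁, ε^{dnm-1} p₂)`. -/
theorem stmt_3 (d n m : ℕ) (hd : 0 < d) (hn : 0 < n) (hm : 0 < m)
    (hmn : Nat.gcd m n = 1) (p q : ℂ × ℂ) :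
    (∃ ζ : ℂ, ζ ^ n = 1 ∧
      ((q.1 ^ (d * n), q.2 ^ (d * n), q.1 * q.2) : ℂ × ℂ × ℂ) =
        (ζ * p.1 ^ (d * n), ζ⁻¹ * p.2 ^ (d * n), ζ ^ m * (p.1 * p.2))) ↔
    (∃ ε : ℂ, ε ^ (d * n ^ 2) = 1 ∧ q = (ε * p.1, ε ^ (d * n * m - 1) * p.2)) := by
  obtain ⟨p₁, p₂⟩ := p
  obtain ⟨q₁, q₂⟩ := q
  have hN : 0 < d * n := Nat.mul_pos hd hn
  obtain ⟨k, hk⟩ : ∃ k, d * n * m = k + 1 :=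
    Nat.exists_eq_succ_of_ne_zero (Nat.mul_pos hN hm).ne'
  have hsq : d * n ^ 2 = d * n * n := by ring
  have hk2 : (k + 2) * k + 1 = d * n ^ 2 * (d * m ^ 2) := by
    calc (k + 2) * k + 1 = (k + 1) ^ 2 := by ring
      _ = d * n ^ 2 * (d * m ^ 2) := by rw [← hk]; ring
  simp only [Prod.mk.injEq, hk, Nat.add_sub_cancel]
  constructor
  · rintro ⟨ζ, hζ, h1, h2, h3⟩
    have hζ0 : ζ ≠ 0 := by
      rintro rfl
      simp [hn.ne'] at hζ
    by_cases hp₁ : p₁ = 0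
    · subst hp₁
      have hq₁ : q₁ = 0 := by
        rw [zero_pow hN.ne', mul_zero] at h1
        exact eq_zero_of_pow_eq_zero h1
      subst hq₁
      by_cases hp₂ : p₂ = 0
      · subst hp₂
        have hq₂ : q₂ = 0 := by
          rw [zero_pow hN.ne', mul_zero] at h2
          exact eq_zero_of_pow_eq_zero h2
        exact ⟨1, by simp, by simp, by simp [hq₂]⟩
      · obtain ⟨η, rfl⟩ : ∃ η, q₂ = η * p₂ := ⟨q₂ / p₂, by field_simp⟩
        have hη : η ^ (d * n) = ζ⁻¹ := by
          rw [mul_pow] at h2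
          exact mul_right_cancel₀ (pow_ne_zero _ hp₂) h2
        have hη1 : η ^ (d * n ^ 2) = 1 := by
          rw [hsq, pow_mul, hη, inv_pow, hζ, inv_one]
        have hη0 : η ≠ 0 := by
          rintro rfl
          rw [zero_pow hN.ne'] at hη
          exact inv_ne_zero hζ0 hη.symm
        refine ⟨η⁻¹ ^ (k + 2), ?_, by simp, ?_⟩
        · rw [← pow_mul, mul_comm, pow_mul, inv_pow, hη1, inv_one, one_pow]
        · congr 1
          have h : η⁻¹ ^ ((k + 2) * k) * η⁻¹ = 1 := by
            rw [← pow_succ, hk2, pow_mul, inv_pow, hη1, inv_one, one_pow]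
          rw [← pow_mul]
          exact ((mul_inv_eq_one₀ hη0).mp h).symm
    · obtain ⟨ε, rfl⟩ : ∃ ε, q₁ = ε * p₁ := ⟨q₁ / p₁, by field_simp⟩
      have hε : ε ^ (d * n) = ζ := by
        rw [mul_pow] at h1
        exact mul_right_cancel₀ (pow_ne_zero _ hp₁) h1
      have hε0 : ε ≠ 0 := by
        rintro rfl
        rw [zero_pow hN.ne'] at hε
        exact hζ0 hε.symm
      refine ⟨ε, by rw [hsq, pow_mul, hε, hζ], rfl, ?_⟩
      rw [← hε, ← pow_mul, hk] at h3
      refine mul_left_cancel₀ (mul_ne_zero hε0 hp₁) (h3.trans ?_)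
      ring
  · rintro ⟨ε, hε, rfl, rfl⟩
    refine ⟨ε ^ (d * n), by rw [← pow_mul, ← hsq, hε], mul_pow _ _ _, ?_, ?_⟩
    · have h : (ε ^ k) ^ (d * n) * ε ^ (d * n) = 1 := by
        rw [← mul_pow, ← pow_succ, ← hk, ← pow_mul,
          show d * n * m * (d * n) = d * n ^ 2 * (d * m) by ring, pow_mul, hε, one_pow]
      rw [mul_pow, eq_inv_of_mul_eq_one_left h]
    · rw [← pow_mul, hk]
      ring
end

section
/- Fix positive integers a, b, c, n, d, m and distinct nonzero complex numbers a_1, …, a_l together with positive integers k_1, …, k_l with ∑ k_j = d, and assume a + b = dnc, am ≡ c (mod n), and gcd(c,n) = 1. Let ℂ* act on ℂ⁴ ∖ {0} by λ·(x,y,z,w) = (λ^a x, λ^b y, λ^c z, λ^n w), let M̄ be the set of ℂ*-orbits of points (x,y,z,w) ∈ ℂ⁴ ∖ {0} satisfying xy = ∏_{j=1}^{l}(z^n − a_j w^c)^{k_j}, and let Y = {(x,y,z) ∈ ℂ³ : xy = ∏_{j=1}^{l}(z^n − a_j)^{k_j}}. Then the map Y → M̄ sending (x,y,z) to the orbit of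 (x,y,z,1): (i) sends two points of Y to the same orbit if and only if they lie in the same orbit of the (1/n)(1,−1,m)-action of the n-th roots of unity on Y; (ii) has image exactly the set of orbits in M̄ whose representatives (x,y,z,w) have w ≠ 0. In particular, it induces a bijection from Y modulo the (1/n)(1,−1,m)-action onto M̄ ∩ {w ≠ 0}. -/
theorem pow_eq_pow_of_modEq_of_pow_eq_one {M : Type*} [Monoid M] {x : M} {n i j : ℕ}
    (hx : x ^ n = 1) (h : i ≡ j [MOD n]) : x ^ i = x ^ j := by
  rw [pow_eq_pow_mod i hx, pow_eq_pow_mod j hx, h]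

/-- If `a` is coprime to `n`, then every `n`-th root of unity is the `a`-th power of an `n`-th root
of unity. -/
theorem exists_pow_eq_of_pow_eq_one_of_coprime {G : Type*} [Group G] {a n : ℕ}
    (h : a.Coprime n) {x : G} (hx : x ^ n = 1) : ∃ y : G, y ^ n = 1 ∧ y ^ a = x := by
  refine ⟨x ^ a.gcdA n, ?_, ?_⟩
  · rw [← zpow_natCast, zpow_comm, zpow_natCast, hx, one_zpow]
  · have hbez := Nat.gcd_eq_gcd_ab a n
    rw [h.gcd_eq_one, Nat.cast_one] at hbez
    calc (x ^ a.gcdA n) ^ a = x ^ (a * a.gcdA n + n * a.gcdB n : ℤ) := by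
          rw [zpow_add, zpow_mul x n, zpow_natCast x n, hx, one_zpow, mul_one, mul_comm, zpow_mul,
            zpow_natCast]
      _ = x := by rw [← hbez, zpow_one]

theorem prod_weighted_homogeneous {R ι : Type*} [CommRing R] [Fintype ι] (α : ι → R) (k : ι → ℕ)
    (n c : ℕ) (t z : R) :
    ∏ j, ((t ^ c * z) ^ n - α j * (t ^ n) ^ c) ^ k j =
      t ^ ((∑ j, k j) * n * c) * ∏ j, (z ^ n - α j) ^ k j := by
  rw [Finset.sum_mul, Finset.sum_mul, ← Finset.prod_pow_eq_pow_sum, ← Finset.prod_mul_distrib]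
  refine Finset.prod_congr rfl fun j _ ↦ ?_
  rw [mul_assoc, mul_comm (k j), pow_mul, ← mul_pow]
  congr 1
  ring

/-- Let `ℂ*` act on `ℂ⁴ \ {0}` with weights `(a,b,c,n)`, let `M̄` be the set of orbits of
points satisfying `xy = ∏ (zⁿ - aⱼ w^c)^{kⱼ}`, and let
`Y = {(x,y,z) : xy = ∏ (zⁿ - aⱼ)^{kⱼ}}`. Then the map `Y → M̄`, `(x,y,z) ↦ [x:y:z:1]`:
(i) identifies two points of `Y` iff they lie in the same orbit of the `(1/n)(1,-1,m)`-action
of the `n`-th roots of unity on `Y`;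
(ii) has image exactly the orbits in `M̄` whose representatives have `w ≠ 0`. -/
theorem stmt_8 (a b c n d m l : ℕ) (ha : 0 < a) (hb : 0 < b) (hc : 0 < c)
    (hn : 0 < n) (hd : 0 < d) (hm : 0 < m)
    (aj : Fin l → ℂ) (hinj : Function.Injective aj) (hne : ∀ j, aj j ≠ 0)
    (k : Fin l → ℕ) (hk : ∀ j, 0 < k j) (hsum : ∑ j, k j = d)
    (hhom : a + b = d * n * c) (hact : a * m ≡ c [MOD n])
    (hgcd : Nat.gcd c n = 1) :
    (∀ p q : ℂ × ℂ × ℂ,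
      p.1 * p.2.1 = ∏ j, (p.2.2 ^ n - aj j) ^ k j →
      q.1 * q.2.1 = ∏ j, (q.2.2 ^ n - aj j) ^ k j →
      ((∃ lam : ℂ, lam ≠ 0 ∧
          ((q.1, q.2.1, q.2.2, (1 : ℂ)) : ℂ × ℂ × ℂ × ℂ) =
            (lam ^ a * p.1, lam ^ b * p.2.1, lam ^ c * p.2.2, lam ^ n * 1)) ↔
        ∃ ρ : ℂ, ρ ^ n = 1 ∧ q = (ρ * p.1, ρ⁻¹ * p.2.1, ρ ^ m * p.2.2))) ∧
    (∀ x y z w : ℂ, ((x, y, z, w) : ℂ × ℂ × ℂ × ℂ) ≠ 0 →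
      x * y = ∏ j, (z ^ n - aj j * w ^ c) ^ k j →
      (w ≠ 0 ↔
        ∃ p : ℂ × ℂ × ℂ,
          p.1 * p.2.1 = ∏ j, (p.2.2 ^ n - aj j) ^ k j ∧
          ∃ lam : ℂ, lam ≠ 0 ∧
            ((x, y, z, w) : ℂ × ℂ × ℂ × ℂ) =
              (lam ^ a * p.1, lam ^ b * p.2.1, lam ^ c * p.2.2, lam ^ n))) := by
  have hcop : a.Coprime n := by
    refine Nat.Coprime.coprime_mul_right (k := m) ?_
    rw [Nat.coprime_iff_gcd_eq_one, hact.gcd_eq, hgcd]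
  have hpow_b : ∀ t : ℂ, t ^ n = 1 → t ^ b = (t ^ a)⁻¹ := by
    intro t ht
    refine eq_inv_of_mul_eq_one_right ?_
    rw [← pow_add, hhom, mul_comm d n, mul_assoc, pow_mul, ht, one_pow]
  have hpow_c : ∀ t : ℂ, t ^ n = 1 → t ^ c = (t ^ a) ^ m := by
    intro t ht
    rw [← pow_mul, pow_eq_pow_of_modEq_of_pow_eq_one ht hact]
  refine ⟨?_, ?_⟩
  · rintro ⟨x, y, z⟩ ⟨x', y', z'⟩ - -
    simp only [Prod.mk.injEq, mul_one]
    constructor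
    · rintro ⟨t, -, rfl, rfl, rfl, ht⟩
      refine ⟨t ^ a, ?_, rfl, ?_, ?_⟩
      · rw [pow_right_comm, ← ht, one_pow]
      · rw [hpow_b t ht.symm]
      · rw [hpow_c t ht.symm]
    · rintro ⟨ρ, hρ, rfl, rfl, rfl⟩
      have hρ0 : ρ ≠ 0 := by
        rintro rfl
        simp [hn.ne'] at hρ
      obtain ⟨t, htn, hta⟩ := exists_pow_eq_of_pow_eq_one_of_coprime hcop
        (x := Units.mk0 ρ hρ0) (Units.ext (by simpa using hρ))
      have htn' : (t : ℂ) ^ n = 1 := by simpa using congrArg Units.val htn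
      have hta' : (t : ℂ) ^ a = ρ := by simpa using congrArg Units.val hta
      refine ⟨t, t.ne_zero, ?_, ?_, ?_, htn'.symm⟩
      · rw [hta']
      · rw [hpow_b t htn', hta']
      · rw [hpow_c t htn', hta']
  · intro x y z w _ hxy
    constructor
    · intro hw
      obtain ⟨t, rfl⟩ := IsAlgClosed.exists_pow_nat_eq w hn
      have ht : t ≠ 0 := by
        rintro rfl
        simp [hn.ne'] at hw
      have hx : x = t ^ a * (x / t ^ a) := by field_simp
      have hy : y = t ^ b * (y / t ^ b) := by field_simp
      have hz : z = t ^ c * (z / t ^ c) := by field_simp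
      refine ⟨(x / t ^ a, y / t ^ b, z / t ^ c), ?_, t, ht, ?_⟩
      · refine mul_left_cancel₀ (pow_ne_zero (d * n * c) ht) ?_
        rw [← hsum, ← prod_weighted_homogeneous, ← hz, ← hxy, hsum, ← hhom, pow_add]
        field_simp
      · simp only [Prod.mk.injEq, and_true]
        exact ⟨hx, hy, hz⟩
    · rintro ⟨p, -, t, ht, h⟩
      simp only [Prod.mk.injEq] at h
      rw [h.2.2.2]
      exact pow_ne_zero n ht
end

section
/- Let n ≥ 1 be an integer, let a_1, …, a_l ∈ ℂ be distinct and nonzero, and let k_1, …, k_l be positive integers. Let F(X,Y,Z) = XY − ∏_{j=1}^{l}(Z^n − a_j)^{k_j}, a polynomial in three variables. Then the set of points (X,Y,Z) ∈ ℂ³ at which F and all three partial derivatives ∂F/∂X, ∂F/∂Y, ∂F/∂Z vanish simultaneously is exactly {(0, 0, ζ) : ζ ∈ ℂ, ζ^n = a_j for some j with k_j ≥ 2}. In particular, the affine hypersurface {F = 0} is smooth if and only if k_j = 1 for all j. -/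
open MvPolynomial

/-- The polynomial `F = XY - ∏ (Zⁿ - aⱼ)^{kⱼ}` in three variables, where the `aⱼ` are
distinct and nonzero. -/
noncomputable def F9 (n l : ℕ) (aj : Fin l → ℂ) (k : Fin l → ℕ) :
    MvPolynomial (Fin 3) ℂ :=
  X 0 * X 1 - ∏ j, (X 2 ^ n - C (aj j)) ^ k j

theorem eval_F9 (n l : ℕ) (aj : Fin l → ℂ) (k : Fin l → ℕ) (p : Fin 3 → ℂ) :
    eval p (F9 n l aj k) = p 0 * p 1 - ∏ j, (p 2 ^ n - aj j) ^ k j := by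
  simp [F9]

theorem pderiv_prod_eq_zero (n l : ℕ) (aj : Fin l → ℂ) (k : Fin l → ℕ) (i : Fin 3)
    (hi : i ≠ 2) :
    pderiv i (∏ j, (X 2 ^ n - C (aj j)) ^ k j : MvPolynomial (Fin 3) ℂ) = 0 := by
  have h (j : Fin l) :
      pderiv i ((X 2 ^ n - C (aj j)) ^ k j : MvPolynomial (Fin 3) ℂ) = 0 := by
    simp [pderiv_X_of_ne hi.symm]
  exact Finset.prod_induction _ (fun q => pderiv i q = 0)
    (fun a b ha hb => by rw [pderiv_mul, ha, hb, zero_mul, mul_zero, add_zero])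
    pderiv_one fun j _ => h j

theorem eval_pderiv_zero_F9 (n l : ℕ) (aj : Fin l → ℂ) (k : Fin l → ℕ) (p : Fin 3 → ℂ) :
    eval p (pderiv 0 (F9 n l aj k)) = p 1 := by
  have h : (1 : Fin 3) ≠ 0 := by decide
  rw [F9, map_sub, pderiv_prod_eq_zero n l aj k 0 (by decide)]
  simp [pderiv_X_of_ne h]

theorem eval_pderiv_one_F9 (n l : ℕ) (aj : Fin l → ℂ) (k : Fin l → ℕ) (p : Fin 3 → ℂ) :
    eval p (pderiv 1 (F9 n l aj k)) = p 0 := by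
  have h : (0 : Fin 3) ≠ 1 := by decide
  rw [F9, map_sub, pderiv_prod_eq_zero n l aj k 1 (by decide)]
  simp [pderiv_X_of_ne h]

/-- At a root `ζ` of `Zⁿ = aⱼ`, the `Z`-derivative of `F` vanishes iff the factor
`Zⁿ - aⱼ` is repeated. -/
theorem eval_pderiv_two_F9_eq_zero_iff (n : ℕ) (hn : 1 ≤ n) (l : ℕ) (aj : Fin l → ℂ)
    (hinj : Function.Injective aj) (hne : ∀ j, aj j ≠ 0)
    (k : Fin l → ℕ) (hk : ∀ j, 0 < k j) (p : Fin 3 → ℂ) (j : Fin l) (hj : p 2 ^ n = aj j) :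
    eval p (pderiv 2 (F9 n l aj k)) = 0 ↔ 2 ≤ k j := by
  have h0 : (0 : Fin 3) ≠ 2 := by decide
  have h1 : (1 : Fin 3) ≠ 2 := by decide
  have hz : p 2 ≠ 0 := by
    intro h
    rw [h, zero_pow (by lia)] at hj
    exact hne j hj.symm
  have hrest : ∏ i ∈ Finset.univ.erase j, (aj j - aj i) ^ k i ≠ 0 := by
    refine Finset.prod_ne_zero_iff.mpr fun i hi => pow_ne_zero _ (sub_ne_zero.mpr ?_)
    exact fun h => Finset.ne_of_mem_erase hi (hinj h).symm
  have hn' : (n : ℂ) ≠ 0 := Nat.cast_ne_zero.mpr (by lia)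
  have hk' : (k j : ℂ) ≠ 0 := Nat.cast_ne_zero.mpr (hk j).ne'
  rw [F9, ← Finset.mul_prod_erase _ _ (Finset.mem_univ j)]
  simp [pderiv_X_of_ne h0, pderiv_X_of_ne h1, hj, hrest,
    hn', hk', hz, (hk j).ne']
  lia

/-- The common zero set of `F = XY - ∏ (Zⁿ - aⱼ)^{kⱼ}` and its three partial derivatives
is exactly `{(0,0,ζ) : ζⁿ = aⱼ for some j with kⱼ ≥ 2}`. In particular, the hypersurface
`{F = 0}` is smooth iff `kⱼ = 1` for all `j`. -/
theorem stmt_9 (n : ℕ) (hn : 1 ≤ n) (l : ℕ) (aj : Fin l → ℂ)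
    (hinj : Function.Injective aj) (hne : ∀ j, aj j ≠ 0)
    (k : Fin l → ℕ) (hk : ∀ j, 0 < k j) :
    ({p : Fin 3 → ℂ |
        eval p (F9 n l aj k) = 0 ∧
        eval p (pderiv 0 (F9 n l aj k)) = 0 ∧
        eval p (pderiv 1 (F9 n l aj k)) = 0 ∧
        eval p (pderiv 2 (F9 n l aj k)) = 0} =
      {p : Fin 3 → ℂ | p 0 = 0 ∧ p 1 = 0 ∧ ∃ j, 2 ≤ k j ∧ (p 2) ^ n = aj j}) ∧
    ((∀ p : Fin 3 → ℂ, eval p (F9 n l aj k) = 0 →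
        ¬(eval p (pderiv 0 (F9 n l aj k)) = 0 ∧
          eval p (pderiv 1 (F9 n l aj k)) = 0 ∧
          eval p (pderiv 2 (F9 n l aj k)) = 0)) ↔
      ∀ j, k j = 1) := by
  have hsing : {p : Fin 3 → ℂ |
        eval p (F9 n l aj k) = 0 ∧
        eval p (pderiv 0 (F9 n l aj k)) = 0 ∧
        eval p (pderiv 1 (F9 n l aj k)) = 0 ∧
        eval p (pderiv 2 (F9 n l aj k)) = 0} =
      {p : Fin 3 → ℂ | p 0 = 0 ∧ p 1 = 0 ∧ ∃ j, 2 ≤ k j ∧ (p 2) ^ n = aj j} := by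
    ext p
    simp only [Set.mem_ofPred_eq, eval_F9, eval_pderiv_zero_F9, eval_pderiv_one_F9]
    constructor
    · rintro ⟨hF, hp1, hp0, hd⟩
      rw [hp0, zero_mul, zero_sub, neg_eq_zero, Finset.prod_eq_zero_iff] at hF
      obtain ⟨j, -, hj⟩ := hF
      have hj' : p 2 ^ n = aj j := sub_eq_zero.mp (eq_zero_of_pow_eq_zero hj)
      exact ⟨hp0, hp1, j,
        (eval_pderiv_two_F9_eq_zero_iff n hn l aj hinj hne k hk p j hj').mp hd, hj'⟩
    · rintro ⟨hp0, hp1, j, hkj, hj⟩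
      refine ⟨?_, hp1, hp0,
        (eval_pderiv_two_F9_eq_zero_iff n hn l aj hinj hne k hk p j hj).mpr hkj⟩
      rw [hp0, zero_mul, zero_sub, neg_eq_zero]
      exact Finset.prod_eq_zero (Finset.mem_univ j) (by rw [hj, sub_self, zero_pow (hk j).ne'])
  refine ⟨hsing, fun h j => ?_, fun h p hF hd => ?_⟩
  · by_contra hkj
    obtain ⟨z, hz⟩ := IsAlgClosed.exists_pow_nat_eq (aj j) (n := n) hn
    have hmem : ![0, 0, z] ∈
        {p : Fin 3 → ℂ | p 0 = 0 ∧ p 1 = 0 ∧ ∃ j, 2 ≤ k j ∧ (p 2) ^ n = aj j} :=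
      ⟨rfl, rfl, j, by have := hk j; lia, hz⟩
    rw [← hsing] at hmem
    exact h _ hmem.1 hmem.2
  · obtain ⟨-, -, j, hkj, -⟩ := hsing.subset ⟨hF, hd⟩
    have := h j
    lia
end

section
/- Let p, q ≥ 1 be coprime integers and let f : ℂ² → ℂ³ be defined by f(u,v) = (u^p, u^q v, v^p). Then: (i) the image of f is exactly {(Z, W, T) ∈ ℂ³ : T·Z^q = W^p}; (ii) for (u,v), (u_1,v_1) ∈ ℂ², one has f(u,v) = f(u_1,v_1) if and only if there exists ρ ∈ ℂ with ρ^p = 1 such that (u_1, v_1) = (ρ u, ρ^{-q} v). In other words, f is a surjection onto the hypersurface {T Z^q = W^p} whose fibers are exactly the orbits of the (1/p)(1, −q)-action of the p-th roots of unity on ℂ². -/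
/-- In a field, taking `q`-th powers is surjective on `p`-th roots of unity if `p` and `q` are
coprime. -/
theorem exists_pow_eq_one_and_zpow_neg_eq {K : Type*} [Field K] {p q : ℕ} (hp : p ≠ 0)
    (hpq : Nat.gcd p q = 1) {σ : K} (hσ : σ ^ p = 1) :
    ∃ ρ : K, ρ ^ p = 1 ∧ ρ ^ (-(q : ℤ)) = σ := by
  have hσ0 : σ ≠ 0 := by
    rintro rfl
    simp [hp] at hσ
  have hσz : σ ^ (p : ℤ) = 1 := by simpa using hσ
  have hbez : (1 : ℤ) = p * Nat.gcdA p q + q * Nat.gcdB p q := by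
    simpa [hpq] using Nat.gcd_eq_gcd_ab p q
  refine ⟨σ ^ (-Nat.gcdB p q), ?_, ?_⟩
  · rw [← zpow_natCast, zpow_comm, hσz, one_zpow]
  · have hexp : -Nat.gcdB p q * -(q : ℤ) = 1 + p * -Nat.gcdA p q := by linarith
    rw [← zpow_mul, hexp, zpow_add₀ hσ0, zpow_mul, hσz, one_zpow, mul_one, zpow_one]


/-- For coprime `p, q ≥ 1` and `f(u,v) = (u^p, u^q v, v^p)`:
(i) the image of `f` is exactly `{(Z,W,T) : T Z^q = W^p}`;
(ii) the fibers of `f` are exactly the orbits of the `(1/p)(1,-q)`-action of the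
`p`-th roots of unity on `ℂ²`. -/
theorem stmt_10 (p q : ℕ) (hp : 1 ≤ p) (hq : 1 ≤ q) (hpq : Nat.gcd p q = 1) :
    (Set.range (fun u : ℂ × ℂ => ((u.1 ^ p, u.1 ^ q * u.2, u.2 ^ p) : ℂ × ℂ × ℂ)) =
      {t : ℂ × ℂ × ℂ | t.2.2 * t.1 ^ q = t.2.1 ^ p}) ∧
    (∀ u v : ℂ × ℂ,
      ((u.1 ^ p, u.1 ^ q * u.2, u.2 ^ p) : ℂ × ℂ × ℂ) =
          (v.1 ^ p, v.1 ^ q * v.2, v.2 ^ p) ↔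
        ∃ ρ : ℂ, ρ ^ p = 1 ∧ v = (ρ * u.1, ρ ^ (-(q : ℤ)) * u.2)) := by
  have hp0 : p ≠ 0 := by omega
  have hq0 : q ≠ 0 := by omega
  refine ⟨?_, ?_⟩
  · ext ⟨Z, W, T⟩
    simp only [Set.mem_range, Set.mem_ofPred_eq, Prod.mk.injEq, Prod.exists]
    constructor
    · rintro ⟨a, b, rfl, rfl, rfl⟩
      ring
    · intro h
      obtain ⟨a, rfl⟩ := IsAlgClosed.exists_pow_nat_eq Z hp
      obtain rfl | ha := eq_or_ne a 0
      · have hW : W = 0 := by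
          rw [zero_pow hp0, zero_pow hq0, mul_zero] at h
          exact (pow_eq_zero_iff hp0).1 h.symm
        obtain ⟨b, rfl⟩ := IsAlgClosed.exists_pow_nat_eq T hp
        exact ⟨0, b, rfl, by rw [hW, zero_pow hq0, zero_mul], rfl⟩
      · refine ⟨a, W / a ^ q, rfl, by field_simp, ?_⟩
        rw [div_pow, ← h, ← pow_mul, ← pow_mul, mul_comm q p]
        field_simp
  · rintro ⟨a, b⟩ ⟨c, d⟩
    simp only [Prod.mk.injEq]
    constructor
    · rintro ⟨h1, h2, h3⟩
      obtain rfl | ha := eq_or_ne a 0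
      · have hc : c = 0 := by
          rw [zero_pow hp0] at h1
          exact (pow_eq_zero_iff hp0).1 h1.symm
        obtain rfl | hb := eq_or_ne b 0
        · have hd : d = 0 := by
            rw [zero_pow hp0] at h3
            exact (pow_eq_zero_iff hp0).1 h3.symm
          exact ⟨1, one_pow p, by simp [hc], by simp [hd]⟩
        · have hσ : (d / b) ^ p = 1 := by
            rw [div_pow, ← h3, div_self (pow_ne_zero p hb)]
          obtain ⟨ρ, hρ, hρσ⟩ := exists_pow_eq_one_and_zpow_neg_eq hp0 hpq hσ
          exact ⟨ρ, hρ, by simp [hc], by rw [hρσ, div_mul_cancel₀ d hb]⟩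
      · have hc : c ≠ 0 := by
          rintro rfl
          rw [zero_pow hp0] at h1
          exact ha ((pow_eq_zero_iff hp0).1 h1)
        refine ⟨c / a, ?_, (div_mul_cancel₀ c ha).symm, ?_⟩
        · rw [div_pow, ← h1, div_self (pow_ne_zero p ha)]
        · rw [zpow_neg, zpow_natCast, div_pow, inv_div, div_mul_eq_mul_div, h2,
            mul_div_cancel_left₀ d (pow_ne_zero q hc)]
    · rintro ⟨ρ, hρ, rfl, rfl⟩
      have hρ0 : ρ ≠ 0 := by
        rintro rfl
        simp [hp0] at hρ
      rw [zpow_neg, zpow_natCast]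
      refine ⟨by rw [mul_pow, hρ, one_mul], ?_, ?_⟩
      · field_simp
        ring
      · rw [mul_pow, inv_pow, ← pow_mul, mul_comm q p, pow_mul, hρ, one_pow, inv_one, one_mul]
end

section
/- Let b ≥ 1 be an integer, let c, n ≥ 1 be coprime integers, let f : ℂ² → ℂ³ be f(u,v) = (u^c, u^n v, v^c), and let the b-th roots of unity act on ℂ³ by α·(Z,W,T) = (α^c Z, α^n W, T) for α^b = 1. Then for all (u,v), (u_1,v_1) ∈ ℂ², the following are equivalent: (a) there exists α ∈ ℂ with α^b = 1 such that α·f(u,v) = f(u_1,v_1); (b) there exist α, ρ ∈ ℂ with α^b = 1 and ρ^c = 1 such that (u_1, v_1) = (α ρ u, ρ^{-n} v). In other words, the fibers of the composition of f with the quotient of ℂ³ by this μ_b-action are exactly the orbits of the combined action of the b-th and c-th roots of unity on ℂ² given by (α, ρ)·(u,v) = (α ρ u, ρ^{-n} v). -/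
/-- If `n` is coprime to `c`, every `c`-th root of unity is the `(-n)`-th power of one. -/
theorem exists_zpow_neg_eq_of_pow_eq_one {G : Type*} [DivisionRing G] {c n : ℕ}
    (hcn : Nat.gcd c n = 1) {ζ : G} (hζ₀ : ζ ≠ 0) (hζ : ζ ^ c = 1) :
    ∃ ρ : G, ρ ^ c = 1 ∧ ρ ^ (-(n : ℤ)) = ζ := by
  have hbez : (1 : ℤ) = c * Nat.gcdA c n + n * Nat.gcdB c n := by
    simpa [hcn] using Nat.gcd_eq_gcd_ab c n
  have hζz : ζ ^ (c : ℤ) = 1 := by rw [zpow_natCast, hζ]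
  refine ⟨ζ ^ (-Nat.gcdB c n), ?_, ?_⟩
  · rw [← zpow_natCast, ← zpow_mul, mul_comm, zpow_mul, hζz, one_zpow]
  · calc (ζ ^ (-Nat.gcdB c n)) ^ (-(n : ℤ))
        = ζ ^ ((c : ℤ) * Nat.gcdA c n + n * Nat.gcdB c n) := by
          rw [zpow_add₀ hζ₀, zpow_mul ζ (c : ℤ), hζz, one_zpow, one_mul, ← zpow_mul]
          congr 1
          ring
      _ = ζ := by rw [← hbez, zpow_one]

/-- For `b ≥ 1`, coprime `c, n ≥ 1`, `f(u,v) = (u^c, uⁿv, v^c)`, and the `μ_b`-action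
`α·(Z,W,T) = (α^c Z, αⁿ W, T)` on `ℂ³`, the following are equivalent:
(a) there is `α` with `α^b = 1` and `α·f(u,v) = f(u₁,v₁)`;
(b) there are `α, ρ` with `α^b = 1`, `ρ^c = 1`, and `(u₁,v₁) = (αρu, ρ⁻ⁿv)`. -/
theorem stmt_11 (b c n : ℕ) (hb : 1 ≤ b) (hc : 1 ≤ c) (hn : 1 ≤ n)
    (hcn : Nat.gcd c n = 1) (u v u₁ v₁ : ℂ) :
    (∃ α : ℂ, α ^ b = 1 ∧
      ((α ^ c * u ^ c, α ^ n * (u ^ n * v), v ^ c) : ℂ × ℂ × ℂ) =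
        (u₁ ^ c, u₁ ^ n * v₁, v₁ ^ c)) ↔
    (∃ α ρ : ℂ, α ^ b = 1 ∧ ρ ^ c = 1 ∧
      u₁ = α * ρ * u ∧ v₁ = ρ ^ (-(n : ℤ)) * v) := by
  have hc₀ : c ≠ 0 := by omega
  have hb₀ : b ≠ 0 := by omega
  constructor
  · rintro ⟨α, hα, h⟩
    obtain ⟨hZ, hW, hT⟩ : α ^ c * u ^ c = u₁ ^ c ∧ α ^ n * (u ^ n * v) = u₁ ^ n * v₁ ∧
        v ^ c = v₁ ^ c := by simpa only [Prod.mk.injEq] using h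
    have hα₀ : α ≠ 0 := by
      rintro rfl
      simp [hb₀] at hα
    by_cases hu : u = 0
    · subst hu
      have hu₁ : u₁ = 0 := by
        rw [zero_pow hc₀, mul_zero] at hZ
        exact eq_zero_of_pow_eq_zero hZ.symm
      by_cases hv : v = 0
      · subst hv
        rw [zero_pow hc₀] at hT
        exact ⟨α, 1, hα, one_pow c, by simp [hu₁], by simp [eq_zero_of_pow_eq_zero hT.symm]⟩
      · have hv₁ : v₁ ≠ 0 := by
          rintro rfl
          rw [zero_pow hc₀] at hT
          exact hv (eq_zero_of_pow_eq_zero hT)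
        obtain ⟨ρ, hρ, hρn⟩ := exists_zpow_neg_eq_of_pow_eq_one hcn (div_ne_zero hv₁ hv)
          (by rw [div_pow, hT, div_self (pow_ne_zero c hv₁)])
        exact ⟨α, ρ, hα, hρ, by simp [hu₁], by rw [hρn, div_mul_cancel₀ v₁ hv]⟩
    · have hαu : α * u ≠ 0 := mul_ne_zero hα₀ hu
      have hu₁ : u₁ ≠ 0 := by
        rintro rfl
        rw [zero_pow hc₀, ← mul_pow] at hZ
        exact pow_ne_zero c hαu hZ
      refine ⟨α, u₁ / (α * u), hα, ?_, by field_simp, ?_⟩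
      · rw [div_pow, mul_pow, hZ, div_self (pow_ne_zero c hu₁)]
      · rw [zpow_neg, zpow_natCast, div_pow, inv_div, mul_pow, div_mul_eq_mul_div, mul_assoc, hW,
          mul_div_cancel_left₀ v₁ (pow_ne_zero n hu₁)]
  · rintro ⟨α, ρ, hα, hρ, rfl, rfl⟩
    have hρ₀ : ρ ≠ 0 := by
      rintro rfl
      simp [hc₀] at hρ
    refine ⟨α, hα, ?_⟩
    rw [Prod.mk.injEq, Prod.mk.injEq]
    refine ⟨?_, ?_, ?_⟩
    · rw [mul_pow, mul_pow, hρ, mul_one]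
    · rw [zpow_neg, zpow_natCast]
      field_simp
      ring
    · rw [mul_pow, zpow_neg, zpow_natCast, inv_pow, pow_right_comm, hρ, one_pow, inv_one, one_mul]
end
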